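/- Let d ≥ 2, let u, v, w be real numbers, and let T be a DOS(u,v,w) operator on real symmetric d×d matrices. For each index i, let L_i be the symmetric d×d matrix whose (i,i) entry is w − u, whose (i,k) and (k,i) entries equal −v for every k ≠ i, and whose all other entries are 0. Then T(L_i) = u·L_i; that is, each L_i is an eigenvector of T with eigenvalue u. -/

import Mathlib

open Matrix

/-- The matrix `L_i`: entry `(i,i)` equals `w - u`, entries `(i,k)` and `(k,i)`
for `k ≠ i` equal `-v`, and all other entries are `0`. -/
def Lmat (d : ℕ) (u v w : ℝ) (i : Fin d) : Matrix (Fin d) (Fin d) ℝ :=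
  Matrix.of fun a b =>
    if a = i ∧ b = i then w - u
    else if a = i ∨ b = i then -v
    else 0

theorem Lmat_isSymm (d : ℕ) (u v w : ℝ) (i : Fin d) : (Lmat d u v w i).IsSymm := by
  ext a b
  simp only [Matrix.transpose_apply, Lmat, Matrix.of_apply, and_comm, or_comm]

/-- **Diagonal-type eigenvectors of a DOS operator.**
If `T` is a DOS(u,v,w) operator on real symmetric `d × d` matrices, then each
matrix `L_i` satisfies `T L_i = u • L_i`. -/
theorem dos_L_eigenvector (d : ℕ) (hd : 2 ≤ d) (u v w : ℝ)
    (T : Matrix (Fin d) (Fin d) ℝ →ₗ[ℝ] Matrix (Fin d) (Fin d) ℝ)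
    (hdiag : ∀ C : Matrix (Fin d) (Fin d) ℝ, C.IsSymm → ∀ i, T C i i = u * C i i)
    (hoff : ∀ C : Matrix (Fin d) (Fin d) ℝ, C.IsSymm → ∀ i j, i ≠ j →
      T C i j = v * C i i + v * C j j + w * C i j)
    (i : Fin d) :
    T (Lmat d u v w i) = u • Lmat d u v w i := by
  ext a b
  have hS := Lmat_isSymm d u v w i
  rw [Matrix.smul_apply, smul_eq_mul]
  by_cases hab : a = b
  · subst hab
    exact hdiag _ hS a
  · rw [hoff _ hS a b hab]
    simp only [Lmat, Matrix.of_apply]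
    grind
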